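/- Let p be a prime, let G be a finite p-group, and let H be a subgroup of G. Then the dominion of H in G in the category Nil of all nilpotent groups is trivial: dom_G^Nil(H) = H. -/

import Mathlib

universe u

/-- The dominion of a subset `S` of a group `G` in a class `C` of groups:
the set of elements of `G` on which any two homomorphisms into a group of `C`
agreeing on `S` must agree. -/
def dominion {G : Type u} [Group G] (C : ∀ (K : Type u) [Group K], Prop) (S : Set G) : Set G :=
  {a | ∀ (K : Type u) [Group K], C K → ∀ f g : G →* K, (∀ x ∈ S, f x = g x) → f a = g a}

/-- A semidirect product of p-groups is a p-group. -/
theorem SemidirectProduct.isPGroup {p : ℕ} {N G : Type*} [Group N] [Group G]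
    {φ : G →* MulAut N} (hN : IsPGroup p N) (hG : IsPGroup p G) :
    IsPGroup p (N ⋊[φ] G) := by
  intro x
  obtain ⟨k, hk⟩ := hG x.right
  have hr : (x ^ p ^ k).right = 1 := by
    rw [← hk]
    exact map_pow (SemidirectProduct.rightHom (φ := φ)) x _
  have hx : x ^ p ^ k = SemidirectProduct.inl (x ^ p ^ k).left := by
    ext <;> simp [hr]
  obtain ⟨m, hm⟩ := hN (x ^ p ^ k).left
  exact ⟨k + m, by rw [pow_add, pow_mul, hx, ← map_pow, hm, map_one]⟩

/-- Conjugation by `n : N` in `N ⋊[φ] G` fixes exactly the elements of `G` whose action fixes `n`. -/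
theorem SemidirectProduct.conj_inl_inr_eq_inr_iff {N G : Type*} [Group N] [Group G]
    {φ : G →* MulAut N} (n : N) (g : G) :
    MulAut.conj (inl n : N ⋊[φ] G) (inr g) = inr g ↔ φ g n = n := by
  rw [MulAut.conj_apply, SemidirectProduct.ext_iff]
  simp [mul_inv_eq_one, eq_comm (a := n)]

open scoped Classical in
/-- The indicator of the coset `H` is fixed exactly by the elements of `H`. -/
theorem mulAutArrow_mulSingle_eq_iff {G : Type*} [Group G] (H : Subgroup G) {M : Type*} [Group M]
    {c : M} (hc : c ≠ 1) (g : G) :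
    mulAutArrow g (Pi.mulSingle ((1 : G) : G ⧸ H) c) = Pi.mulSingle ((1 : G) : G ⧸ H) c ↔
      g ∈ H := by
  have key : ∀ a : G ⧸ H, mulAutArrow g (Pi.mulSingle ((1 : G) : G ⧸ H) c) a =
      (Pi.mulSingle ((1 : G) : G ⧸ H) c : G ⧸ H → M) (g⁻¹ • a) := fun _ => rfl
  have hfix : g⁻¹ • ((1 : G) : G ⧸ H) = ((1 : G) : G ⧸ H) ↔ g ∈ H := by
    rw [MulAction.Quotient.smul_coe, eq_comm, QuotientGroup.eq]
    simp
  constructor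
  · intro h
    by_contra hg
    have h1 := congrFun h ((1 : G) : G ⧸ H)
    rw [key, Pi.mulSingle_eq_same, Pi.mulSingle_eq_of_ne (mt hfix.1 hg)] at h1
    exact hc h1.symm
  · intro hg
    funext a
    rw [key]
    by_cases ha : a = ((1 : G) : G ⧸ H)
    · rw [ha, hfix.2 hg]
    · rw [Pi.mulSingle_eq_of_ne ha, Pi.mulSingle_eq_of_ne]
      rwa [Ne, ← hfix.2 hg, (MulAction.injective g⁻¹).eq_iff]

/-- Dominions of subgroups of finite p-groups are trivial in the class of all
nilpotent groups. -/
theorem dominion_trivial_pGroup_in_nilpotent (p : ℕ) (hp : p.Prime)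
    (G : Type u) [Group G] [Finite G] (hG : IsPGroup p G) (H : Subgroup G) :
    dominion (fun (K : Type u) [Group K] => Group.IsNilpotent K) (H : Set G) =
      (H : Set G) := by
  classical
  have : Fact p.Prime := ⟨hp⟩
  refine Set.Subset.antisymm (fun a ha => ?_) fun a ha K _ _ f g hfg => hfg a ha
  let M := Multiplicative (ZMod p)
  let K := (G ⧸ H → M) ⋊[mulAutArrow] G
  have : Finite M := inferInstanceAs (Finite (ZMod p))
  have : Finite K := Finite.of_equiv _ SemidirectProduct.equivProd.symm
  have hM : IsPGroup p (G ⧸ H → M) := fun f => ⟨1, funext fun x =>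
    Multiplicative.toAdd.injective (by simp [M])⟩
  have hK : IsPGroup p K := SemidirectProduct.isPGroup hM hG
  have hc : (Multiplicative.ofAdd (1 : ZMod p) : M) ≠ 1 := by simp
  let δ : G ⧸ H → M := Pi.mulSingle ((1 : G) : G ⧸ H) (Multiplicative.ofAdd (1 : ZMod p))
  have hδ : ∀ x : G, MulAut.conj (SemidirectProduct.inl δ : K) (SemidirectProduct.inr x) =
      SemidirectProduct.inr x ↔ x ∈ H := fun x =>
    (SemidirectProduct.conj_inl_inr_eq_inr_iff δ x).trans (mulAutArrow_mulSingle_eq_iff H hc x)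
  exact (hδ a).1 (ha K hK.isNilpotent
    ((MulAut.conj (SemidirectProduct.inl δ : K)).toMonoidHom.comp SemidirectProduct.inr)
    SemidirectProduct.inr fun x hx => (hδ x).2 hx)
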